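/- arXiv:2412.13972 — 5 statements merged into one kernel-verified Lean document; each statement's English description precedes it below -/
import Mathlib

section
/- In a market consisting of two agents and a single trade ω, the alternating best response dynamic terminates (both agents become satisfied) after at most O(V) best responses; i.e., there is an absolute constant C such that from any state with all offers and valuations bounded in absolute value by V, the dynamic terminates within C·(V+1) best responses. -/
open Finset

/-- A trading market: a set `I` of agents, a set `Ω` of bilateral trades, each with a
buyer and a distinct seller, integer-valued valuations over bundles of trades, and a
(unique, tie-broken) demanded bundle at every price vector. -/
structure Market (I Ω : Type) [DecidableEq I] where
  buyer : Ω → I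
  seller : Ω → I
  buyer_ne_seller : ∀ ω, buyer ω ≠ seller ω
  v : I → Finset Ω → ℤ
  demand : I → (Ω → ℤ) → Finset Ω
  demand_involves : ∀ i p, ∀ ω ∈ demand i p, buyer ω = i ∨ seller ω = i
  demand_max : ∀ (i : I) (p : Ω → ℤ) (Ψ : Finset Ω),
    (∀ ω ∈ Ψ, buyer ω = i ∨ seller ω = i) →
    v i Ψ - ∑ ω ∈ Ψ, (if buyer ω = i then (1 : ℤ) else if seller ω = i then -1 else 0) * p ω ≤
      v i (demand i p) -
        ∑ ω ∈ demand i p,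
          (if buyer ω = i then (1 : ℤ) else if seller ω = i then -1 else 0) * p ω

/-- A state of the market dynamic: the set of unsatisfied agents and the current offers
`offers i ω` of agent `i` for trade `ω`. -/
structure MState (I Ω : Type) where
  unsat : Finset I
  offers : I → Ω → ℤ

namespace Market

variable {I Ω : Type} [Fintype I] [DecidableEq I] [Fintype Ω] [DecidableEq Ω]

/-- The sign `χ^i_ω`: `1` if `i` buys `ω`, `-1` if `i` sells `ω`, `0` otherwise. -/
def chi (M : Market I Ω) (i : I) (ω : Ω) : ℤ :=
  if M.buyer ω = i then 1 else if M.seller ω = i then -1 else 0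

/-- Quasilinear utility of agent `i` for bundle `Ψ` at prices `p`. -/
def utility (M : Market I Ω) (i : I) (Ψ : Finset Ω) (p : Ω → ℤ) : ℤ :=
  M.v i Ψ - ∑ ω ∈ Ψ, M.chi i ω * p ω

/-- The valuation of the empty bundle is `0`. -/
def Normalized (M : Market I Ω) : Prop := ∀ i : I, M.v i (∅ : Finset Ω) = 0

/-- The prices facing agent `i`: the counterpart's offer `σ^{-i}_ω` for each trade `ω`. -/
def price (M : Market I Ω) (σ : I → Ω → ℤ) (i : I) (ω : Ω) : ℤ :=
  if M.buyer ω = i then σ (M.seller ω) ω else σ (M.buyer ω) ω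

/-- The best response (with step size `ε = 1`) of agent `i` given current offers `σ`:
she matches the counterpart's offer on the trades she demands, and moves off by `1`
(in her favourable direction) otherwise.  Offers of other agents are unchanged. -/
def bestResponse (M : Market I Ω) (σ : I → Ω → ℤ) (i : I) : I → Ω → ℤ := fun j ω =>
  if j = i ∧ (M.buyer ω = i ∨ M.seller ω = i) then
    (if ω ∈ M.demand i (M.price σ i) then M.price σ i ω
     else M.price σ i ω - M.chi i ω)
  else σ j ω

/-- One step of the market dynamic: agent `i` best responds, becomes satisfied, and all
counterparts facing a modified offer become unsatisfied. -/
def mstep (M : Market I Ω) (s : MState I Ω) (i : I) : MState I Ω :=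
  { unsat := (s.unsat.erase i) ∪ (Finset.univ.filter fun j =>
      j ≠ i ∧ ∃ ω : Ω,
        ((M.buyer ω = i ∧ M.seller ω = j) ∨ (M.buyer ω = j ∧ M.seller ω = i)) ∧
        M.bestResponse s.offers i i ω ≠ s.offers i ω),
    offers := M.bestResponse s.offers i }

/-- Running the dynamic along a finite sequence of best-responding agents. -/
def mrun (M : Market I Ω) : MState I Ω → List I → MState I Ω
  | s, [] => s
  | s, i :: L => M.mrun (M.mstep s i) L

/-- A best response sequence of the dynamic is valid if every selected agent is
unsatisfied when selected. -/
def ValidSeq (M : Market I Ω) : MState I Ω → List I → Prop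
  | _, [] => True
  | s, i :: L => i ∈ s.unsat ∧ M.ValidSeq (M.mstep s i) L

/-- A (valid) best response sequence after which the market dynamic terminates, i.e.,
all agents are satisfied. -/
def TerminatingSeq (M : Market I Ω) (s : MState I Ω) (L : List I) : Prop :=
  M.ValidSeq s L ∧ (M.mrun s L).unsat = ∅

/-- Full substitutability of the demand of agent `i` (Hatfield et al.). -/
def FullySubstitutable (M : Market I Ω) (i : I) : Prop :=
  ∀ p p' : Ω → ℤ,
    (((∀ ω, M.seller ω = i → p ω = p' ω) ∧ (∀ ω, M.buyer ω = i → p' ω ≤ p ω)) →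
      ((∀ ω ∈ M.demand i p, M.seller ω = i → ω ∈ M.demand i p') ∧
       (∀ ω ∈ M.demand i p', M.buyer ω = i → p ω = p' ω → ω ∈ M.demand i p))) ∧
    (((∀ ω, M.buyer ω = i → p ω = p' ω) ∧ (∀ ω, M.seller ω = i → p ω ≤ p' ω)) →
      ((∀ ω ∈ M.demand i p, M.buyer ω = i → ω ∈ M.demand i p') ∧
       (∀ ω ∈ M.demand i p', M.seller ω = i → p ω = p' ω → ω ∈ M.demand i p)))

/-- A market with fully substitutable agents. -/
def FSM (M : Market I Ω) : Prop := ∀ i : I, M.FullySubstitutable i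

end Market

namespace Market

variable {Ω : Type} [Fintype Ω] [DecidableEq Ω]

/-- The alternating best response dynamic of a two-agent market, starting with agent `a`:
`altRun M s a n` is the state after `n` best responses. -/
def altRun (M : Market Bool Ω) : MState Bool Ω → Bool → ℕ → MState Bool Ω
  | s, _, 0 => s
  | s, a, n + 1 => M.altRun (M.mstep s a) (!a) n

/-- The alternating best response dynamic terminates (all agents become satisfied). -/
def AltConverges (M : Market Bool Ω) (s : MState Bool Ω) (a : Bool) : Prop :=
  ∃ n : ℕ, (M.altRun s a n).unsat = ∅

end Market

namespace Market

/-- With a single trade, an agent demands it when it has positive surplus at the price she faces,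
and only if this surplus is nonnegative. -/
lemma demand_unit_spec (M : Market Bool Unit) (hN : M.Normalized) (i : Bool) (q : ℤ) :
    (() ∈ M.demand i (fun _ => q) → M.chi i () * q ≤ M.v i {()}) ∧
      (() ∉ M.demand i (fun _ => q) → M.v i {()} ≤ M.chi i () * q) := by
  have hinv : M.buyer () = i ∨ M.seller () = i := by
    have := M.buyer_ne_seller ()
    revert this
    cases M.buyer () <;> cases M.seller () <;> cases i <;> simp
  have h0 := hN i
  constructor
  · intro h
    have hD : M.demand i (fun _ => q) = {()} := by
      ext x
      simpa using h
    have hmax := M.demand_max i (fun _ => q) ∅ (by simp)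
    rw [hD] at hmax
    simp only [sum_empty, sum_singleton, h0] at hmax
    unfold chi
    linarith
  · intro h
    have hD : M.demand i (fun _ => q) = ∅ := by
      ext x
      simpa using h
    have hmax := M.demand_max i (fun _ => q) {()} (fun _ _ => hinv)
    rw [hD] at hmax
    simp only [sum_empty, sum_singleton, h0] at hmax
    unfold chi
    linarith

/-- The buyer of a single trade demands it exactly up to some threshold price. -/
lemma exists_buyer_threshold (M : Market Bool Unit) (hN : M.Normalized) {V : ℕ}
    (hV : ∀ (i : Bool) (Ψ : Finset Unit), |M.v i Ψ| ≤ (V : ℤ)) :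
    ∃ β : ℤ, |β| ≤ V + 1 ∧
      ∀ q : ℤ, () ∈ M.demand (M.buyer ()) (fun _ => q) ↔ q ≤ β := by
  obtain ⟨v, hv⟩ : ∃ v, v = M.v (M.buyer ()) {()} := ⟨_, rfl⟩
  have hb := abs_le.mp (hV (M.buyer ()) {()})
  have hspec := M.demand_unit_spec hN (M.buyer ())
  simp only [chi, if_true, one_mul, ← hv] at hspec
  by_cases htie : () ∈ M.demand (M.buyer ()) (fun _ => v)
  · refine ⟨v, abs_le.mpr (by omega), fun q => ⟨(hspec q).1, fun hq => ?_⟩⟩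
    by_contra h
    obtain rfl : q = v := le_antisymm hq ((hspec q).2 h)
    exact h htie
  · refine ⟨v - 1, abs_le.mpr (by omega), fun q => ⟨fun h => ?_, fun hq => ?_⟩⟩
    · have hne : q ≠ v := fun e => htie (e ▸ h)
      have := (hspec q).1 h
      omega
    · by_contra h
      have := (hspec q).2 h
      omega

/-- The seller of a single trade demands it exactly from some threshold price on. -/
lemma exists_seller_threshold (M : Market Bool Unit) (hN : M.Normalized) {V : ℕ}
    (hV : ∀ (i : Bool) (Ψ : Finset Unit), |M.v i Ψ| ≤ (V : ℤ)) :
    ∃ α : ℤ, |α| ≤ V + 1 ∧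
      ∀ q : ℤ, () ∈ M.demand (M.seller ()) (fun _ => q) ↔ α ≤ q := by
  obtain ⟨v, hv⟩ : ∃ v, v = -M.v (M.seller ()) {()} := ⟨_, rfl⟩
  have hb := abs_le.mp (hV (M.seller ()) {()})
  have hspec := M.demand_unit_spec hN (M.seller ())
  simp only [chi, if_neg (M.buyer_ne_seller ()), if_true] at hspec
  by_cases htie : () ∈ M.demand (M.seller ()) (fun _ => v)
  · refine ⟨v, abs_le.mpr (by omega), fun q => ⟨fun h => ?_, fun hq => ?_⟩⟩
    · have := (hspec q).1 h
      omega
    · by_contra h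
      have := (hspec q).2 h
      have hqv : q = v := by omega
      exact h (hqv ▸ htie)
  · refine ⟨v + 1, abs_le.mpr (by omega), fun q => ⟨fun h => ?_, fun hq => ?_⟩⟩
    · have hne : q ≠ v := fun e => htie (e ▸ h)
      have := (hspec q).1 h
      omega
    · by_contra h
      have := (hspec q).2 h
      omega

lemma mstep_buyer_offer (M : Market Bool Unit) {β : ℤ}
    (hβ : ∀ q : ℤ, () ∈ M.demand (M.buyer ()) (fun _ => q) ↔ q ≤ β) (t : MState Bool Unit) :
    (M.mstep t (M.buyer ())).offers (M.buyer ()) () =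
      if t.offers (M.seller ()) () ≤ β then t.offers (M.seller ()) ()
      else t.offers (M.seller ()) () - 1 := by
  have hp : M.price t.offers (M.buyer ()) = fun _ => t.offers (M.seller ()) () := by
    ext ⟨⟩
    simp [price]
  simp only [mstep, bestResponse, hp, hβ]
  simp [chi]

lemma mstep_seller_offer (M : Market Bool Unit) {α : ℤ}
    (hα : ∀ q : ℤ, () ∈ M.demand (M.seller ()) (fun _ => q) ↔ α ≤ q) (t : MState Bool Unit) :
    (M.mstep t (M.seller ())).offers (M.seller ()) () =
      if α ≤ t.offers (M.buyer ()) () then t.offers (M.buyer ()) ()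
      else t.offers (M.buyer ()) () + 1 := by
  have hp : M.price t.offers (M.seller ()) = fun _ => t.offers (M.buyer ()) () := by
    ext ⟨⟩
    simp [price, M.buyer_ne_seller ()]
  simp only [mstep, bestResponse, hp, hα]
  simp [chi, M.buyer_ne_seller ()]

lemma mstep_offers_of_ne (M : Market Bool Unit) (t : MState Bool Unit) {i j : Bool}
    (h : j ≠ i) : (M.mstep t i).offers j = t.offers j := by
  ext ω
  simp [mstep, bestResponse, h]

/-- After both agents have best responded, all agents are satisfied provided the second one
did not change her offer. -/
lemma mstep_mstep_unsat_eq_empty (M : Market Bool Unit) (t : MState Bool Unit) {i j : Bool}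
    (hij : j ≠ i)
    (h : (M.mstep (M.mstep t i) j).offers j () = t.offers j ()) :
    (M.mstep (M.mstep t i) j).unsat = ∅ := by
  have h' : M.bestResponse (M.mstep t i).offers j j () = (M.mstep t i).offers j () := by
    rw [M.mstep_offers_of_ne t hij]
    exact h
  ext k
  have hk : k = i ∨ k = j := by
    revert hij
    cases i <;> cases j <;> cases k <;> simp
  rcases hk with rfl | rfl
  · simp [mstep] at h' ⊢
    grind
  · simp [mstep]

/-- The alternating dynamic terminates within a number of rounds bounded by the distance of the
seller's offer from the interval spanned by the thresholds. -/
lemma exists_altRun_buyer_unsat_eq_empty (M : Market Bool Unit) {α β : ℤ}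
    (hα : ∀ q : ℤ, () ∈ M.demand (M.seller ()) (fun _ => q) ↔ α ≤ q)
    (hβ : ∀ q : ℤ, () ∈ M.demand (M.buyer ()) (fun _ => q) ↔ q ≤ β) (k : ℕ) :
    ∀ t : MState Bool Unit, t.offers (M.seller ()) () - max α β ≤ k →
      min α (β + 1) - t.offers (M.seller ()) () ≤ k →
      ∃ n ≤ 2 * (k + 1), (M.altRun t (M.buyer ()) n).unsat = ∅ := by
  have hne := M.buyer_ne_seller ()
  have hnot : (!M.buyer ()) = M.seller () := by
    revert hne
    cases M.buyer () <;> cases M.seller () <;> simp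
  have hnot' : (!M.seller ()) = M.buyer () := by rw [← hnot, Bool.not_not]
  induction k with
  | zero =>
    intro t h1 h2
    refine ⟨2, le_rfl, ?_⟩
    simp only [altRun, hnot]
    apply M.mstep_mstep_unsat_eq_empty t hne.symm
    rw [M.mstep_seller_offer hα, M.mstep_buyer_offer hβ]
    split_ifs <;> omega
  | succ k ih =>
    intro t h1 h2
    have hq := M.mstep_seller_offer hα (M.mstep t (M.buyer ()))
    rw [M.mstep_buyer_offer hβ] at hq
    by_cases hfix : (M.mstep (M.mstep t (M.buyer ())) (M.seller ())).offers (M.seller ()) () =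
        t.offers (M.seller ()) ()
    · refine ⟨2, by omega, ?_⟩
      simp only [altRun, hnot]
      exact M.mstep_mstep_unsat_eq_empty t hne.symm hfix
    · obtain ⟨n, hn, hrun⟩ := ih (M.mstep (M.mstep t (M.buyer ())) (M.seller ()))
        (by split_ifs at hq <;> omega) (by split_ifs at hq <;> omega)
      refine ⟨n + 2, by omega, ?_⟩
      simpa only [altRun, hnot, hnot'] using hrun

end Market

/-- A two-agent market with a single trade converges under the alternating
best response dynamic within `C * (V + 1)` best responses, for an absolute constant `C`,
from any state whose offers and valuations are bounded in absolute value by `V`. -/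
theorem two_agent_single_trade_converges_in_O_V :
    ∃ C : ℕ, ∀ (M : Market Bool Unit), M.Normalized →
      ∀ V : ℕ, (∀ (i : Bool) (Ψ : Finset Unit), |M.v i Ψ| ≤ (V : ℤ)) →
      ∀ s : MState Bool Unit, (∀ (i : Bool) (ω : Unit), |s.offers i ω| ≤ (V : ℤ)) →
      ∀ a : Bool, ∃ n ≤ C * (V + 1), (Market.altRun M s a n).unsat = ∅ := by
  refine ⟨7, fun M hN V hV s hs a => ?_⟩
  obtain ⟨α, hαV, hα⟩ := M.exists_seller_threshold hN hV
  obtain ⟨β, hβV, hβ⟩ := M.exists_buyer_threshold hN hV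
  rw [abs_le] at hαV hβV
  have hb := abs_le.mp (hs (M.buyer ()) ())
  have hs' := abs_le.mp (hs (M.seller ()) ())
  have hne := M.buyer_ne_seller ()
  by_cases ha : a = M.buyer ()
  · subst ha
    obtain ⟨n, hn, h⟩ := M.exists_altRun_buyer_unsat_eq_empty hα hβ (2 * V + 2) s
      (by push_cast; omega) (by push_cast; omega)
    exact ⟨n, by omega, h⟩
  · obtain rfl : a = M.seller () := by
      revert ha hne
      cases M.buyer () <;> cases M.seller () <;> cases a <;> simp
    have hnot : (!M.seller ()) = M.buyer () := by
      revert hne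
      cases M.buyer () <;> cases M.seller () <;> simp
    have hq := M.mstep_seller_offer hα s
    obtain ⟨n, hn, h⟩ := M.exists_altRun_buyer_unsat_eq_empty hα hβ (2 * V + 2)
      (M.mstep s (M.seller ()))
      (by push_cast; split_ifs at hq <;> omega) (by push_cast; split_ifs at hq <;> omega)
    refine ⟨n + 1, by omega, ?_⟩
    simpa only [Market.altRun, hnot] using h
end

section
/- In a market consisting of two fully-substitutable agents and two trades between them, the alternating best response dynamic terminates after at most O(V²) best responses; i.e., there is an absolute constant C such that from any state with all offers and valuations bounded in absolute value by V, the dynamic terminates within C·(V+1)² best responses. -/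
open Finset

namespace Market

variable {Ω : Type}

theorem buyer_eq_or_seller_eq (M : Market Bool Ω) (i : Bool) (ω : Ω) :
    M.buyer ω = i ∨ M.seller ω = i := by
  have := M.buyer_ne_seller ω
  cases h : M.buyer ω <;> cases h' : M.seller ω <;> cases i <;> simp_all

theorem chi_eq_one_or (M : Market Bool Ω) (i : Bool) (ω : Ω) :
    M.chi i ω = 1 ∨ M.chi i ω = -1 := by
  rcases M.buyer_eq_or_seller_eq i ω with h | h
  · simp [chi, h]
  · by_cases h' : M.buyer ω = i <;> simp [chi, h, h']

theorem chi_not (M : Market Bool Ω) (i : Bool) (ω : Ω) : M.chi (!i) ω = -M.chi i ω := by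
  have := M.buyer_ne_seller ω
  cases h : M.buyer ω <;> cases h' : M.seller ω <;> cases i <;> simp_all [chi]

theorem price_eq (M : Market Bool Ω) (σ : Bool → Ω → ℤ) (i : Bool) :
    M.price σ i = σ (!i) := by
  funext ω
  have := M.buyer_ne_seller ω
  cases h : M.buyer ω <;> cases h' : M.seller ω <;> cases i <;> simp_all [price]

variable [DecidableEq Ω]

/-- The offers with which agent `i` best responds to the prices `p`. -/
def response (M : Market Bool Ω) (i : Bool) (p : Ω → ℤ) : Ω → ℤ := fun ω =>
  if ω ∈ M.demand i p then p ω else p ω - M.chi i ω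

theorem bestResponse_self (M : Market Bool Ω) (σ : Bool → Ω → ℤ) (i : Bool) :
    M.bestResponse σ i i = M.response i (σ (!i)) := by
  funext ω
  simp [bestResponse, response, price_eq, M.buyer_eq_or_seller_eq i ω]

theorem bestResponse_of_ne (M : Market Bool Ω) (σ : Bool → Ω → ℤ) {i j : Bool} (h : j ≠ i) :
    M.bestResponse σ i j = σ j := by
  funext ω
  simp [bestResponse, h]

theorem response_eq_or (M : Market Bool Ω) (i : Bool) (p : Ω → ℤ) (ω : Ω) :
    M.response i p ω = p ω ∨ M.response i p ω = p ω - M.chi i ω := by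
  unfold response
  split_ifs <;> simp

/-- Best responses of a fully substitutable agent are monotone in the prices. -/
theorem FullySubstitutable.monotone_response {M : Market Bool Ω} {i : Bool}
    (h : M.FullySubstitutable i) : Monotone (M.response i) := by
  intro p p' hp ω
  set q : Ω → ℤ := fun ω => if M.buyer ω = i then p' ω else p ω with hq
  have hs : ∀ ω, M.seller ω = i → M.buyer ω ≠ i := fun ω hω hb =>
    M.buyer_ne_seller ω (hb.trans hω.symm)
  obtain ⟨h₁, h₂⟩ := (h q p).1 ⟨fun ω hω => by simp [hq, hs ω hω], fun ω hω => by
    simpa [hq, hω] using hp ω⟩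
  obtain ⟨h₃, h₄⟩ := (h q p').2 ⟨fun ω hω => by simp [hq, hω], fun ω hω => by
    simpa [hq, hs ω hω] using hp ω⟩
  have hω := hp ω
  by_cases hb : M.buyer ω = i
  · have hc : M.chi i ω = 1 := by simp [chi, hb]
    have hqω : q ω = p' ω := by simp [hq, hb]
    have h₅ : ω ∈ M.demand i p → p ω = p' ω → ω ∈ M.demand i p' := fun hd he =>
      h₃ ω (h₂ ω hd hb (by omega)) hb
    simp only [response, hc]
    grind
  · have hsω : M.seller ω = i := (M.buyer_eq_or_seller_eq i ω).resolve_left hb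
    have hc : M.chi i ω = -1 := by simp [chi, hb, hsω]
    have hqω : q ω = p ω := by simp [hq, hb]
    have h₅ : ω ∈ M.demand i p' → p ω = p' ω → ω ∈ M.demand i p := fun hd he =>
      h₁ ω (h₄ ω hd hsω (by omega)) hsω
    simp only [response, hc]
    grind

theorem neg_two_mul_le_of_notMem_demand (M : Market Bool Ω) {V : ℕ} {i : Bool}
    (hV : ∀ Ψ : Finset Ω, |M.v i Ψ| ≤ (V : ℤ)) {p : Ω → ℤ} {ω : Ω} (hω : ω ∉ M.demand i p) :
    -(2 * V : ℤ) ≤ M.chi i ω * p ω := by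
  have h := M.demand_max i p (insert ω (M.demand i p)) fun ω' _ => M.buyer_eq_or_seller_eq i ω'
  rw [Finset.sum_insert hω] at h
  have h₁ := abs_le.1 (hV (insert ω (M.demand i p)))
  have h₂ := abs_le.1 (hV (M.demand i p))
  unfold chi
  linarith

theorem abs_response_le (M : Market Bool Ω) {V : ℕ} {i : Bool}
    (hV : ∀ Ψ : Finset Ω, |M.v i Ψ| ≤ (V : ℤ)) {p : Ω → ℤ}
    (hp : ∀ ω, |p ω| ≤ ((2 * V + 1 : ℕ) : ℤ)) (ω : Ω) :
    |M.response i p ω| ≤ ((2 * V + 1 : ℕ) : ℤ) := by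
  unfold response
  split_ifs with h
  · exact hp ω
  · have h₁ := M.neg_two_mul_le_of_notMem_demand hV h
    have h₂ := abs_le.1 (hp ω)
    rw [abs_le]
    rcases M.chi_eq_one_or i ω with hc | hc <;> rw [hc] at h₁ ⊢ <;> push_cast at h₂ ⊢ <;>
      constructor <;> linarith

/-- The effect on the second agent's offers of one best response by each of the two agents. -/
def roundTrip (M : Market Bool Ω) (a : Bool) (p : Ω → ℤ) : Ω → ℤ :=
  M.response (!a) (M.response a p)

section

variable [Fintype Ω]

theorem offers_mstep_mstep (M : Market Bool Ω) (s : MState Bool Ω) (a : Bool) :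
    (M.mstep (M.mstep s a) (!a)).offers (!a) = M.roundTrip a (s.offers (!a)) := by
  simp [mstep, bestResponse_self, roundTrip]

/-- If a round of best responses reproduces the second agent's offers, the dynamic has
terminated after that round. -/
theorem unsat_altRun_eq_empty (M : Market Bool Ω) (a : Bool) (t : ℕ) (s : MState Bool Ω)
    (h : M.roundTrip a ((M.roundTrip a)^[t] (s.offers (!a))) =
      (M.roundTrip a)^[t] (s.offers (!a))) :
    (M.altRun s a (2 * t + 2)).unsat = ∅ := by
  induction t generalizing s with
  | zero =>
    have h₁ : ∀ σ : Bool → Ω → ℤ, M.bestResponse σ a (!a) = σ (!a) := fun σ =>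
      M.bestResponse_of_ne σ (by simp)
    have h₂ : M.response (!a) (M.response a (s.offers (!a))) = s.offers (!a) := h
    ext j
    cases j <;> cases a <;> simp_all [altRun, mstep, bestResponse_self]
  | succ t ih =>
    have := ih (M.mstep (M.mstep s a) (!a)) (by
      rw [offers_mstep_mstep]
      simpa only [Function.iterate_succ_apply] using h)
    simpa [altRun, mul_add] using this

end

end Market

/-- A nondecreasing sequence of bounded pairs of integers is stationary at some early step. -/
theorem exists_eq_succ_of_forall_le_succ {y : ℕ → Fin 2 → ℤ} {B : ℕ}
    (hy : ∀ t ω, |y t ω| ≤ (B : ℤ)) (hm : ∀ t, y t ≤ y (t + 1)) :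
    ∃ t ≤ 4 * B, y (t + 1) = y t := by
  by_contra! hne
  have key : ∀ t ≤ 4 * B + 1, y 0 0 + y 0 1 + t ≤ y t 0 + y t 1 := by
    intro t
    induction t with
    | zero => simp
    | succ t ih =>
      intro ht
      have h₁ := ih (by omega)
      have h₂ := hne t (by omega)
      have h₃ : y t 0 ≤ y (t + 1) 0 := hm t 0
      have h₄ : y t 1 ≤ y (t + 1) 1 := hm t 1
      have h₅ : y (t + 1) 0 ≠ y t 0 ∨ y (t + 1) 1 ≠ y t 1 := by
        by_contra! h
        exact h₂ (funext (Fin.forall_fin_two.2 h))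
      push_cast
      omega
  have h := key _ le_rfl
  have h₀ := abs_le.1 (hy 0 0)
  have h₁ := abs_le.1 (hy 0 1)
  have h₂ := abs_le.1 (hy (4 * B + 1) 0)
  have h₃ := abs_le.1 (hy (4 * B + 1) 1)
  push_cast at h
  omega

/-- A bounded orbit of a monotone map on pairs of integers that has, at step `t₀`, two comparable
consecutive points reaches a fixed point soon after `t₀`. -/
theorem exists_fixed_of_comparable {G : (Fin 2 → ℤ) → Fin 2 → ℤ} (hG : Monotone G)
    {p : Fin 2 → ℤ} {B t₀ : ℕ} (hB : ∀ t ω, |G^[t] p ω| ≤ (B : ℤ))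
    (h : G^[t₀] p ≤ G^[t₀ + 1] p ∨ G^[t₀ + 1] p ≤ G^[t₀] p) :
    ∃ t ≤ t₀ + 4 * B, G (G^[t] p) = G^[t] p := by
  have hit : ∀ t, G^[t₀ + (t + 1)] p = G (G^[t₀ + t] p) := fun t =>
    Function.iterate_succ_apply' G (t₀ + t) p
  rcases h with h | h
  · obtain ⟨t, ht, he⟩ := exists_eq_succ_of_forall_le_succ (y := fun t => G^[t₀ + t] p)
      (fun t => hB _) fun t => by
        induction t with
        | zero => exact h
        | succ t ih => simpa only [hit] using hG ih
    exact ⟨t₀ + t, by omega, (hit t).symm.trans he⟩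
  · obtain ⟨t, ht, he⟩ := exists_eq_succ_of_forall_le_succ (y := fun t => -G^[t₀ + t] p)
      (fun t ω => by simpa using hB _ ω) fun t => neg_le_neg (by
        induction t with
        | zero => exact h
        | succ t ih => simpa only [hit] using hG ih)
    exact ⟨t₀ + t, by omega, (hit t).symm.trans (neg_injective he)⟩

/-- Let `f` and `g` be monotone maps on pairs of integers, where `f` moves each coordinate by
`0` or `-c` and `g` by `0` or `c`.  A bounded orbit of `g ∘ f` reaches a fixed point in
linearly many steps. -/
theorem exists_fixed_comp {f g : (Fin 2 → ℤ) → Fin 2 → ℤ} (hf : Monotone f) (hg : Monotone g)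
    {c : Fin 2 → ℤ} (hc : ∀ ω, c ω = 1 ∨ c ω = -1)
    (hfc : ∀ p ω, f p ω = p ω ∨ f p ω = p ω - c ω)
    (hgc : ∀ p ω, g p ω = p ω ∨ g p ω = p ω + c ω)
    {p : Fin 2 → ℤ} {B : ℕ} (hB : ∀ t ω, |(g ∘ f)^[t] p ω| ≤ (B : ℤ)) :
    ∃ t ≤ 6 * B + 1, (g ∘ f) ((g ∘ f)^[t] p) = (g ∘ f)^[t] p := by
  by_cases hcmp : ∃ t₀ ≤ 2 * B + 1, (g ∘ f)^[t₀] p ≤ (g ∘ f)^[t₀ + 1] p ∨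
      (g ∘ f)^[t₀ + 1] p ≤ (g ∘ f)^[t₀] p
  · obtain ⟨t₀, ht₀, h⟩ := hcmp
    obtain ⟨t, ht, he⟩ := exists_fixed_of_comparable (hg.comp hf) hB h
    exact ⟨t, by omega, he⟩
  exfalso
  push Not at hcmp
  set y : ℕ → Fin 2 → ℤ := fun t => (g ∘ f)^[t] p with hy
  have hsucc : ∀ t, y (t + 1) = g (f (y t)) := fun t => Function.iterate_succ_apply' _ t p
  have hd : ∀ t ≤ 2 * B + 1, (y (t + 1) 0 = y t 0 + 1 ∧ y (t + 1) 1 = y t 1 - 1) ∨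
      (y (t + 1) 0 = y t 0 - 1 ∧ y (t + 1) 1 = y t 1 + 1) := by
    intro t ht
    obtain ⟨h₁, h₂⟩ := hcmp t ht
    change ¬ y t ≤ y (t + 1) at h₁
    change ¬ y (t + 1) ≤ y t at h₂
    rw [Pi.le_def, Fin.forall_fin_two] at h₁ h₂
    have e := hsucc t
    have a₀ := hfc (y t) 0
    have a₁ := hfc (y t) 1
    have b₀ := hgc (f (y t)) 0
    have b₁ := hgc (f (y t)) 1
    rw [← e] at b₀ b₁
    have c₀ := hc 0
    have c₁ := hc 1
    omega
  have hrev : ∀ t ≤ 2 * B, y (t + 2) 0 - y (t + 1) 0 = y (t + 1) 0 - y t 0 := by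
    intro t ht
    by_contra hne
    have d₀ := hd t (by omega)
    have d₁ : (y (t + 2) 0 = y (t + 1) 0 + 1 ∧ y (t + 2) 1 = y (t + 1) 1 - 1) ∨
        (y (t + 2) 0 = y (t + 1) 0 - 1 ∧ y (t + 2) 1 = y (t + 1) 1 + 1) :=
      hd (t + 1) (by omega)
    have hx : f (y (t + 1)) = f (y t) := by
      have aux : ∀ ω, y (t + 2) ω ≠ y (t + 1) ω → y (t + 2) ω = y t ω →
          f (y (t + 1)) ω = f (y t) ω := by
        intro ω h₁ h₂
        have a₀ := hfc (y t) ω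
        have a₁ := hfc (y (t + 1)) ω
        have b₀ := hgc (f (y t)) ω
        have b₁ := hgc (f (y (t + 1))) ω
        rw [← hsucc t] at b₀
        rw [← hsucc (t + 1)] at b₁
        change y (t + 2) ω = _ ∨ y (t + 2) ω = _ at b₁
        have := hc ω
        omega
      exact funext (Fin.forall_fin_two.2 ⟨aux 0 (by omega) (by omega), aux 1 (by omega) (by omega)⟩)
    have : y (t + 2) = y (t + 1) := by rw [hsucc (t + 1), hx, ← hsucc]
    have := congrFun this 0
    omega
  have hconst : ∀ t ≤ 2 * B + 1, y (t + 1) 0 - y t 0 = y 1 0 - y 0 0 := by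
    intro t
    induction t with
    | zero => simp
    | succ t ih => exact fun ht => (hrev t (by omega)).trans (ih (by omega))
  have hlin : ∀ t ≤ 2 * B + 1, y t 0 = y 0 0 + t * (y 1 0 - y 0 0) := by
    intro t
    induction t with
    | zero => simp
    | succ t ih =>
      intro ht
      have h₁ := ih (by omega)
      have h₂ := hconst t (by omega)
      push_cast
      linarith
  have h := hlin _ le_rfl
  have h₀ := abs_le.1 (hB 0 0)
  have h₁ := abs_le.1 (hB (2 * B + 1) 0)
  change -(B : ℤ) ≤ y 0 0 ∧ y 0 0 ≤ B at h₀
  change -(B : ℤ) ≤ y (2 * B + 1) 0 ∧ y (2 * B + 1) 0 ≤ B at h₁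
  push_cast at h
  rcases hd 0 (by omega) with h₂ | h₂
  · rw [show y 1 0 - y 0 0 = 1 by have := h₂.1; simp only [zero_add] at this; omega] at h
    omega
  · rw [show y 1 0 - y 0 0 = -1 by have := h₂.1; simp only [zero_add] at this; omega] at h
    omega

/-- A two-agent FSM with two trades converges under the alternating best
response dynamic within `C * (V + 1)^2` best responses, for an absolute constant `C`,
from any state whose offers and valuations are bounded in absolute value by `V`. -/
theorem two_agent_two_trade_FSM_converges_in_O_V_sq :
    ∃ C : ℕ, ∀ (M : Market Bool (Fin 2)), M.Normalized → M.FSM →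
      ∀ V : ℕ, (∀ (i : Bool) (Ψ : Finset (Fin 2)), |M.v i Ψ| ≤ (V : ℤ)) →
      ∀ s : MState Bool (Fin 2), (∀ (i : Bool) (ω : Fin 2), |s.offers i ω| ≤ (V : ℤ)) →
      ∀ a : Bool, ∃ n ≤ C * (V + 1) ^ 2, (Market.altRun M s a n).unsat = ∅ := by
  refine ⟨24, fun M _ hM V hV s hs a => ?_⟩
  have hB : ∀ t ω, |(M.roundTrip a)^[t] (s.offers (!a)) ω| ≤ ((2 * V + 1 : ℕ) : ℤ) := by
    intro t
    induction t with
    | zero => exact fun ω => (hs (!a) ω).trans (by push_cast; omega)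
    | succ t ih =>
      rw [Function.iterate_succ_apply']
      exact M.abs_response_le (hV (!a)) (M.abs_response_le (hV a) ih)
  obtain ⟨t, ht, he⟩ := exists_fixed_comp (hM a).monotone_response (hM (!a)).monotone_response
    (M.chi_eq_one_or a) (M.response_eq_or a)
    (fun p ω => by simpa [M.chi_not] using M.response_eq_or (!a) p ω) hB
  exact ⟨2 * t + 2, by nlinarith, M.unsat_altRun_eq_empty a t s he⟩
end

section
/- There exists a two-agent market with two trades ω, φ (both with the same buyer and seller) for which the alternating best response dynamic never terminates. Concretely, for any sufficiently large integer M, let the buyer's valuation be v^b(∅) = 0, v^b({ω}) = 8, v^b({φ}) = 9, v^b({ω,φ}) = −M, and the seller's valuation be v^s(∅) = 0, v^s({ω}) = −6, v^s({φ}) = −7, v^s({ω,φ}) = −9, with ties broken by the lexicographic rule ∅ ≺ {ω} ≺ {φ} ≺ {ω,φ}. The buyer is fully substitutable but the seller is not. Starting from buyer offers σ^b_ω = 4, σ^b_φ = 5 with the seller best responding first, the offers after the successive best responses are: seller (5,6), buyer (5,5), seller (5,5), buyer (4,5); hence after two best responses by each agent the offers return to their earlier values and the dynamic cycles forever. -/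
open Finset

/-- Rank of a bundle for the lexicographic tie-breaking rule `∅ ≺ {ω} ≺ {φ} ≺ {ω, φ}`
(trade `ω` is `0` and trade `φ` is `1`). -/
def lexRank (Ψ : Finset (Fin 2)) : ℕ :=
  if Ψ = ∅ then 0 else if Ψ = {0} then 1 else if Ψ = {1} then 2 else 3

/-- The first bundle in the order `∅ ≺ {0} ≺ {1} ≺ {0, 1}` of maximal utility, when these
bundles have utilities `0`, `a`, `b`, `c`. -/
def lexArgmax (a b c : ℤ) : Finset (Fin 2) :=
  if a ≤ 0 ∧ b ≤ 0 ∧ c ≤ 0 then ∅ else if b ≤ a ∧ c ≤ a then {0} else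
    if c ≤ b then {1} else {0, 1}

/-- The valuation with `∅ ↦ 0`, `{0} ↦ a`, `{1} ↦ b`, `{0, 1} ↦ c`. -/
def bundleValue (a b c : ℤ) (Ψ : Finset (Fin 2)) : ℤ :=
  if Ψ = ∅ then 0 else if Ψ = {0} then a else if Ψ = {1} then b else c

section bundleValue

variable (a b c : ℤ)

@[simp] lemma bundleValue_empty : bundleValue a b c ∅ = 0 := rfl

@[simp] lemma bundleValue_zero : bundleValue a b c {0} = a := rfl

@[simp] lemma bundleValue_one : bundleValue a b c {1} = b := rfl

@[simp] lemma bundleValue_pair : bundleValue a b c {0, 1} = c := rfl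

end bundleValue

lemma lexRank_values : lexRank ∅ = 0 ∧ lexRank {0} = 1 ∧ lexRank {1} = 2 ∧
    lexRank {0, 1} = 3 := by decide

lemma finset_fin_two_cases (Ψ : Finset (Fin 2)) :
    Ψ = ∅ ∨ Ψ = {0} ∨ Ψ = {1} ∨ Ψ = {0, 1} := by
  revert Ψ; decide

lemma zero_mem_lexArgmax {a b c : ℤ} :
    0 ∈ lexArgmax a b c ↔ ¬(a ≤ 0 ∧ b ≤ 0 ∧ c ≤ 0) ∧ (b ≤ a ∧ c ≤ a ∨ b < c) := by
  unfold lexArgmax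
  split_ifs <;> simp <;> omega

lemma one_mem_lexArgmax {a b c : ℤ} :
    1 ∈ lexArgmax a b c ↔ ¬(a ≤ 0 ∧ b ≤ 0 ∧ c ≤ 0) ∧ ¬(b ≤ a ∧ c ≤ a) := by
  unfold lexArgmax
  split_ifs <;> simp <;> omega

/-- The utility of a bundle at prices `p` for an agent with valuation `bundleValue a b c` for whom
every trade has sign `χ`. -/
def bundleUtility (a b c χ : ℤ) (p : Fin 2 → ℤ) (Ψ : Finset (Fin 2)) : ℤ :=
  bundleValue a b c Ψ - ∑ ω ∈ Ψ, χ * p ω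

lemma bundleUtility_le_lexArgmax (a b c χ : ℤ) (p : Fin 2 → ℤ) (Ψ : Finset (Fin 2)) :
    bundleUtility a b c χ p Ψ ≤ bundleUtility a b c χ p
      (lexArgmax (a - χ * p 0) (b - χ * p 1) (c - χ * p 0 - χ * p 1)) := by
  unfold lexArgmax bundleUtility
  rcases finset_fin_two_cases Ψ with rfl | rfl | rfl | rfl <;>
    split_ifs <;> simp <;> omega

lemma lexRank_lexArgmax_le {a b c χ : ℤ} {p : Fin 2 → ℤ} {Ψ : Finset (Fin 2)}
    (h : bundleUtility a b c χ p Ψ = bundleUtility a b c χ p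
      (lexArgmax (a - χ * p 0) (b - χ * p 1) (c - χ * p 0 - χ * p 1))) :
    lexRank (lexArgmax (a - χ * p 0) (b - χ * p 1) (c - χ * p 0 - χ * p 1)) ≤ lexRank Ψ := by
  obtain ⟨h0, h1, h2, h3⟩ := lexRank_values
  revert h
  unfold lexArgmax bundleUtility
  rcases finset_fin_two_cases Ψ with rfl | rfl | rfl | rfl <;>
    split_ifs <;> simp [h0, h1, h2, h3] <;> omega

/-- The market with a buyer `true` who values both trades together at `-m`, and a seller `false`
for whom the two trades are complements. -/
def cyclingMarket (m : ℤ) : Market Bool (Fin 2) where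
  buyer := fun _ => true
  seller := fun _ => false
  buyer_ne_seller := by simp
  v := fun i => if i then bundleValue 8 9 (-m) else bundleValue (-6) (-7) (-9)
  demand := fun i p =>
    if i then lexArgmax (8 - 1 * p 0) (9 - 1 * p 1) (-m - 1 * p 0 - 1 * p 1)
    else lexArgmax (-6 - -1 * p 0) (-7 - -1 * p 1) (-9 - -1 * p 0 - -1 * p 1)
  demand_involves := by simp
  demand_max := by
    intro i p Ψ _
    cases i
    · exact bundleUtility_le_lexArgmax (-6) (-7) (-9) (-1) p Ψ
    · exact bundleUtility_le_lexArgmax 8 9 (-m) 1 p Ψ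

section cyclingMarket

variable (m : ℤ)

@[simp] lemma cyclingMarket_buyer (ω : Fin 2) : (cyclingMarket m).buyer ω = true := rfl

@[simp] lemma cyclingMarket_seller (ω : Fin 2) : (cyclingMarket m).seller ω = false := rfl

lemma cyclingMarket_demand_true (p : Fin 2 → ℤ) : (cyclingMarket m).demand true p =
    lexArgmax (8 - 1 * p 0) (9 - 1 * p 1) (-m - 1 * p 0 - 1 * p 1) := rfl

lemma cyclingMarket_demand_false (p : Fin 2 → ℤ) : (cyclingMarket m).demand false p =
    lexArgmax (-6 - -1 * p 0) (-7 - -1 * p 1) (-9 - -1 * p 0 - -1 * p 1) := rfl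

lemma cyclingMarket_lexRank_demand_le (i : Bool) (p : Fin 2 → ℤ) (Ψ : Finset (Fin 2))
    (h : (cyclingMarket m).utility i Ψ p =
      (cyclingMarket m).utility i ((cyclingMarket m).demand i p) p) :
    lexRank ((cyclingMarket m).demand i p) ≤ lexRank Ψ := by
  cases i
  · exact lexRank_lexArgmax_le (a := -6) (b := -7) (c := -9) (χ := -1) h
  · exact lexRank_lexArgmax_le (a := 8) (b := 9) (c := -m) (χ := 1) h

lemma cyclingMarket_fullySubstitutable_true (hm : 0 ≤ m) :
    (cyclingMarket m).FullySubstitutable true := by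
  intro p p'
  constructor
  · rintro ⟨-, h⟩
    have h0 := h 0 rfl
    have h1 := h 1 rfl
    refine ⟨by simp, ?_⟩
    simp only [cyclingMarket_demand_true, Fin.forall_fin_two, zero_mem_lexArgmax,
      one_mem_lexArgmax]
    constructor <;> intros <;> omega
  · rintro ⟨h, -⟩
    obtain rfl : p = p' := funext fun ω => h ω rfl
    simp

lemma cyclingMarket_not_fullySubstitutable_false :
    ¬ (cyclingMarket m).FullySubstitutable false := by
  intro h
  have h1 := (h ![4, 5] ![5, 5]).2 ⟨by simp, by simp [Fin.forall_fin_two]⟩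
  have h2 := h1.2 1
  simp [cyclingMarket_demand_false, one_mem_lexArgmax] at h2

variable {m} {s : MState Bool (Fin 2)}

lemma cyclingMarket_mstep_offers_of_ne {i j : Bool} (h : j ≠ i) :
    ((cyclingMarket m).mstep s i).offers j = s.offers j := by
  funext ω
  simp [Market.mstep, Market.bestResponse, h]

/-- The seller's best response to the buyer's offers `x`, `y`. -/
lemma cyclingMarket_mstep_false (x y : ℤ) (hx : s.offers true 0 = x) (hy : s.offers true 1 = y) :
    ((cyclingMarket m).mstep s false).offers false 0 =
        (if 0 ∈ lexArgmax (x - 6) (y - 7) (x + y - 9) then x else x + 1) ∧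
      ((cyclingMarket m).mstep s false).offers false 1 =
        (if 1 ∈ lexArgmax (x - 6) (y - 7) (x + y - 9) then y else y + 1) := by
  have e : lexArgmax (-6 - -1 * x) (-7 - -1 * y) (-9 - -1 * x - -1 * y) =
      lexArgmax (x - 6) (y - 7) (x + y - 9) := by congr 1 <;> ring
  simp [Market.mstep, Market.bestResponse, Market.price, Market.chi, cyclingMarket_demand_false,
    hx, hy, ← e]

/-- The buyer's best response to the seller's offers `x`, `y`. -/
lemma cyclingMarket_mstep_true (x y : ℤ) (hx : s.offers false 0 = x) (hy : s.offers false 1 = y) :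
    ((cyclingMarket m).mstep s true).offers true 0 =
        (if 0 ∈ lexArgmax (8 - x) (9 - y) (-m - x - y) then x else x - 1) ∧
      ((cyclingMarket m).mstep s true).offers true 1 =
        (if 1 ∈ lexArgmax (8 - x) (9 - y) (-m - x - y) then y else y - 1) := by
  simp [Market.mstep, Market.bestResponse, Market.price, Market.chi, cyclingMarket_demand_true,
    hx, hy]

lemma cyclingMarket_mem_unsat {i : Bool} (h : (!i) ∈ s.unsat ∨
    ∃ ω, ((cyclingMarket m).mstep s i).offers i ω ≠ s.offers i ω) :
    (!i) ∈ ((cyclingMarket m).mstep s i).unsat := by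
  simp only [Market.mstep] at h ⊢
  cases i <;> simpa using h

end cyclingMarket

/-- The states `s`, with `i` the next agent to respond, through which the dynamic of
`cyclingMarket` cycles. -/
def OnCycle (s : MState Bool (Fin 2)) (i : Bool) : Prop :=
  i ∈ s.unsat ∧
    ((i = false ∧ s.offers true 0 = 4 ∧ s.offers true 1 = 5 ∧
        (true ∈ s.unsat ∨ s.offers false 1 = 5)) ∨
      (i = true ∧ s.offers true 0 = 4 ∧ s.offers true 1 = 5 ∧
        s.offers false 0 = 5 ∧ s.offers false 1 = 6) ∨
      (i = false ∧ s.offers true 0 = 5 ∧ s.offers true 1 = 5 ∧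
        s.offers false 0 = 5 ∧ s.offers false 1 = 6) ∨
      (i = true ∧ s.offers true 0 = 5 ∧ s.offers true 1 = 5 ∧
        s.offers false 0 = 5 ∧ s.offers false 1 = 5))

section cycle

variable {m : ℤ} {s : MState Bool (Fin 2)}

lemma cyclingMarket_mstep_four_five (h0 : s.offers true 0 = 4) (h1 : s.offers true 1 = 5) :
    ((cyclingMarket m).mstep s false).offers false 0 = 5 ∧
      ((cyclingMarket m).mstep s false).offers false 1 = 6 := by
  simpa [zero_mem_lexArgmax, one_mem_lexArgmax] using cyclingMarket_mstep_false (m := m) 4 5 h0 h1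

lemma cyclingMarket_mstep_five_six (hm : 0 ≤ m) (h0 : s.offers false 0 = 5)
    (h1 : s.offers false 1 = 6) :
    ((cyclingMarket m).mstep s true).offers true 0 = 5 ∧
      ((cyclingMarket m).mstep s true).offers true 1 = 5 := by
  obtain ⟨e0, e1⟩ := cyclingMarket_mstep_true (m := m) 5 6 h0 h1
  rw [if_pos (zero_mem_lexArgmax.2 (by omega))] at e0
  rw [if_neg (mt one_mem_lexArgmax.1 (by omega))] at e1
  exact ⟨e0, e1⟩

lemma cyclingMarket_mstep_false_five_five (h0 : s.offers true 0 = 5) (h1 : s.offers true 1 = 5) :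
    ((cyclingMarket m).mstep s false).offers false 0 = 5 ∧
      ((cyclingMarket m).mstep s false).offers false 1 = 5 := by
  simpa [zero_mem_lexArgmax, one_mem_lexArgmax] using cyclingMarket_mstep_false (m := m) 5 5 h0 h1

lemma cyclingMarket_mstep_true_five_five (hm : 0 ≤ m) (h0 : s.offers false 0 = 5)
    (h1 : s.offers false 1 = 5) :
    ((cyclingMarket m).mstep s true).offers true 0 = 4 ∧
      ((cyclingMarket m).mstep s true).offers true 1 = 5 := by
  obtain ⟨e0, e1⟩ := cyclingMarket_mstep_true (m := m) 5 5 h0 h1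
  rw [if_neg (mt zero_mem_lexArgmax.1 (by omega))] at e0
  rw [if_pos (one_mem_lexArgmax.2 (by omega))] at e1
  exact ⟨e0, e1⟩

lemma OnCycle.mstep (hm : 0 ≤ m) {i : Bool} (h : OnCycle s i) :
    OnCycle ((cyclingMarket m).mstep s i) (!i) := by
  have hT := cyclingMarket_mstep_offers_of_ne (m := m) (s := s) (i := false) (j := true) (by simp)
  have hF := cyclingMarket_mstep_offers_of_ne (m := m) (s := s) (i := true) (j := false) (by simp)
  obtain ⟨-, ⟨rfl, h0, h1, h⟩ | ⟨rfl, h0, h1, h2, h3⟩ | ⟨rfl, h0, h1, h2, h3⟩ |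
    ⟨rfl, h0, h1, h2, h3⟩⟩ := h
  · have e := cyclingMarket_mstep_four_five (m := m) h0 h1
    refine ⟨cyclingMarket_mem_unsat (h.imp_right fun h => ⟨1, ?_⟩), ?_⟩
    · rw [e.2, h]; decide
    · simp [hT, h0, h1, e]
  · have e := cyclingMarket_mstep_five_six hm h2 h3
    refine ⟨cyclingMarket_mem_unsat (.inr ⟨0, ?_⟩), ?_⟩
    · rw [e.1, h0]; decide
    · simp [hF, h2, h3, e]
  · have e := cyclingMarket_mstep_false_five_five (m := m) h0 h1
    refine ⟨cyclingMarket_mem_unsat (.inr ⟨1, ?_⟩), ?_⟩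
    · rw [e.2, h3]; decide
    · simp [hT, h0, h1, e]
  · have e := cyclingMarket_mstep_true_five_five hm h2 h3
    refine ⟨cyclingMarket_mem_unsat (.inr ⟨0, ?_⟩), ?_⟩
    · rw [e.1, h0]; decide
    · simp [hF, h3, e]

lemma OnCycle.altRun_unsat_ne_empty (hm : 0 ≤ m) (n : ℕ) {i : Bool} (h : OnCycle s i) :
    ((cyclingMarket m).altRun s i n).unsat ≠ ∅ := by
  induction n generalizing s i with
  | zero => exact Finset.ne_empty_of_mem h.1
  | succ n ih => exact ih (h.mstep hm)

end cycle

/-- There is a two-agent market with two trades between a buyer (`true`)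
and a seller (`false`) — the buyer fully substitutable, the seller not — whose
alternating best response dynamic, with the seller responding first from buyer offers
`(4, 5)`, produces offers `(5,6), (5,5), (5,5), (4,5)` and cycles, never terminating. -/
theorem complements_cycle_counterexample :
    ∃ M0 : ℤ, ∀ Mbig : ℤ, M0 ≤ Mbig →
      ∃ Mk : Market Bool (Fin 2),
        Mk.buyer = (fun _ => true) ∧
        Mk.seller = (fun _ => false) ∧
        Mk.v true (∅ : Finset (Fin 2)) = 0 ∧
        Mk.v true {0} = 8 ∧ Mk.v true {1} = 9 ∧ Mk.v true {0, 1} = -Mbig ∧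
        Mk.v false (∅ : Finset (Fin 2)) = 0 ∧
        Mk.v false {0} = -6 ∧ Mk.v false {1} = -7 ∧ Mk.v false {0, 1} = -9 ∧
        (∀ (i : Bool) (p : Fin 2 → ℤ) (Ψ : Finset (Fin 2)),
          Mk.utility i Ψ p = Mk.utility i (Mk.demand i p) p →
          lexRank (Mk.demand i p) ≤ lexRank Ψ) ∧
        Mk.FullySubstitutable true ∧
        ¬ Mk.FullySubstitutable false ∧
        (∀ σ0 : Bool → Fin 2 → ℤ, σ0 true 0 = 4 → σ0 true 1 = 5 →
          ((Market.altRun Mk ⟨Finset.univ, σ0⟩ false 1).offers false 0 = 5 ∧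
           (Market.altRun Mk ⟨Finset.univ, σ0⟩ false 1).offers false 1 = 6) ∧
          ((Market.altRun Mk ⟨Finset.univ, σ0⟩ false 2).offers true 0 = 5 ∧
           (Market.altRun Mk ⟨Finset.univ, σ0⟩ false 2).offers true 1 = 5) ∧
          ((Market.altRun Mk ⟨Finset.univ, σ0⟩ false 3).offers false 0 = 5 ∧
           (Market.altRun Mk ⟨Finset.univ, σ0⟩ false 3).offers false 1 = 5) ∧
          ((Market.altRun Mk ⟨Finset.univ, σ0⟩ false 4).offers true 0 = 4 ∧
           (Market.altRun Mk ⟨Finset.univ, σ0⟩ false 4).offers true 1 = 5) ∧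
          (∀ n : ℕ, (Market.altRun Mk ⟨Finset.univ, σ0⟩ false n).unsat ≠ ∅)) := by
  refine ⟨0, fun m hm => ⟨cyclingMarket m, rfl, rfl, rfl, rfl, rfl, rfl, rfl, rfl, rfl, rfl,
    cyclingMarket_lexRank_demand_le m, cyclingMarket_fullySubstitutable_true m hm,
    cyclingMarket_not_fullySubstitutable_false m, fun σ0 h0 h1 => ?_⟩⟩
  have e1 := cyclingMarket_mstep_four_five (m := m) (s := ⟨Finset.univ, σ0⟩) h0 h1
  have e2 := cyclingMarket_mstep_five_six hm e1.1 e1.2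
  have e3 := cyclingMarket_mstep_false_five_five (m := m) e2.1 e2.2
  have e4 := cyclingMarket_mstep_true_five_five hm e3.1 e3.2
  exact ⟨e1, e2, e3, e4, fun n => OnCycle.altRun_unsat_ne_empty hm n
    ⟨Finset.mem_univ _, .inl ⟨rfl, h0, h1, .inl (Finset.mem_univ _)⟩⟩⟩
end

section
/- At any point during the market dynamic, every offer is bounded: −2V−1 ≤ σ^{b(ω)}_ω ≤ 2V+1 and −2V−1 ≤ σ^{s(ω)}_ω ≤ 2V+1 for every trade ω ∈ Ω. Consequently, every best response sequence either terminates or is eventually periodic (cycles); moreover, in a two-agent market every such cycle has even length. -/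
open Finset

namespace Market

section Bounds

variable {I Ω : Type} [DecidableEq I] {M : Market I Ω}

theorem utility_le_utility_demand (M : Market I Ω) (i : I) (p : Ω → ℤ) {Ψ : Finset Ω}
    (hΨ : ∀ ω ∈ Ψ, M.buyer ω = i ∨ M.seller ω = i) :
    M.utility i Ψ p ≤ M.utility i (M.demand i p) p :=
  M.demand_max i p Ψ hΨ

variable [DecidableEq Ω]

/-- A trade that agent `i` does not demand satisfies `χ^i_ω p_ω ≥ -2V`. -/
theorem neg_two_mul_le_chi_mul_of_notMem_demand {V : ℤ} {i : I} (hv : ∀ Ψ, |M.v i Ψ| ≤ V)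
    {p : Ω → ℤ} {ω : Ω} (hω : M.buyer ω = i ∨ M.seller ω = i) (h : ω ∉ M.demand i p) :
    -(2 * V) ≤ M.chi i ω * p ω := by
  have hmax := M.utility_le_utility_demand i p (Ψ := insert ω (M.demand i p)) (by
    intro ω' h'
    rcases mem_insert.1 h' with rfl | h'
    · exact hω
    · exact M.demand_involves i p ω' h')
  rw [utility, utility, sum_insert h] at hmax
  have h₁ := abs_le.1 (hv (M.demand i p))
  have h₂ := abs_le.1 (hv (insert ω (M.demand i p)))
  linarith [h₁.1, h₁.2, h₂.1, h₂.2]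

theorem abs_bestResponse_le {V : ℤ} (hv : ∀ i Ψ, |M.v i Ψ| ≤ V) {σ : I → Ω → ℤ}
    (hσ : ∀ i ω, |σ i ω| ≤ 2 * V + 1) (i j : I) (ω : Ω) :
    |M.bestResponse σ i j ω| ≤ 2 * V + 1 := by
  have hp : |M.price σ i ω| ≤ 2 * V + 1 := by
    unfold price
    split_ifs <;> apply hσ
  unfold bestResponse
  split_ifs with hj hω
  · exact hp
  · have hm := neg_two_mul_le_chi_mul_of_notMem_demand (hv i) hj.2 hω
    rw [abs_le] at hp ⊢
    unfold chi at hm ⊢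
    split_ifs at hm ⊢ <;> constructor <;> grind
  · exact hσ j ω

end Bounds

section Run

variable {I Ω : Type} [Fintype I] [DecidableEq I] [Fintype Ω] [DecidableEq Ω]

theorem abs_mrun_offers_le {M : Market I Ω} {V : ℤ} (hv : ∀ i Ψ, |M.v i Ψ| ≤ V) (L : List I)
    {s : MState I Ω} (hs : ∀ i ω, |s.offers i ω| ≤ 2 * V + 1) (i : I) (ω : Ω) :
    |(M.mrun s L).offers i ω| ≤ 2 * V + 1 := by
  induction L generalizing s with
  | nil => exact hs i ω
  | cons j L ih => exact ih (s := M.mstep s j) (abs_bestResponse_le hv hs j)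

theorem notMem_unsat_mstep (M : Market I Ω) (s : MState I Ω) (i : I) :
    i ∉ (M.mstep s i).unsat := by
  simp [mstep]

theorem finite_setOf_abs_offers_le {I Ω : Type} [Finite I] [Finite Ω] (B : ℤ) :
    {s : MState I Ω | ∀ i ω, |s.offers i ω| ≤ B}.Finite := by
  have hbox : (Set.univ.pi fun _ : I => Set.univ.pi fun _ : Ω => Set.Icc (-B) B).Finite :=
    Set.Finite.pi fun _ => Set.Finite.pi fun _ => Set.finite_Icc _ _
  refine Set.Finite.subset (((Set.finite_univ (α := Finset I)).prod hbox).image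
    fun x => MState.mk x.1 x.2) ?_
  intro s hs
  refine ⟨(s.unsat, s.offers), ⟨Set.mem_univ _, ?_⟩, rfl⟩
  exact fun i _ ω _ => abs_le.1 (hs i ω)

end Run

section Alternating

variable {Ω : Type} [Fintype Ω] [DecidableEq Ω]

/-- One best response of the alternating dynamic, keeping track of the agent to move next. -/
def altStep (M : Market Bool Ω) (x : MState Bool Ω × Bool) : MState Bool Ω × Bool :=
  (M.mstep x.1 x.2, !x.2)

theorem iterate_altStep (M : Market Bool Ω) (s : MState Bool Ω) (a : Bool) (n : ℕ) :
    M.altStep^[n] (s, a) = (M.altRun s a n, not^[n] a) := by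
  induction n generalizing s a with
  | zero => rfl
  | succ n ih => exact ih (M.mstep s a) (!a)

theorem altRun_succ (M : Market Bool Ω) (s : MState Bool Ω) (a : Bool) (n : ℕ) :
    M.altRun s a (n + 1) = M.mstep (M.altRun s a n) (not^[n] a) := by
  have h := Function.iterate_succ_apply' M.altStep n (s, a)
  rw [iterate_altStep, iterate_altStep] at h
  exact congrArg Prod.fst h

theorem abs_altRun_offers_le {M : Market Bool Ω} {V : ℤ} (hv : ∀ i Ψ, |M.v i Ψ| ≤ V)
    {s : MState Bool Ω} (hs : ∀ i ω, |s.offers i ω| ≤ 2 * V + 1) (a : Bool) (n : ℕ)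
    (i : Bool) (ω : Ω) : |(M.altRun s a n).offers i ω| ≤ 2 * V + 1 := by
  induction n generalizing i ω with
  | zero => exact hs i ω
  | succ n ih =>
    rw [altRun_succ]
    exact abs_bestResponse_le hv ih _ i ω

theorem exists_altRun_eventually_periodic (M : Market Bool Ω) (s : MState Bool Ω) (a : Bool) :
    ∃ N k : ℕ, 0 < k ∧ ∀ n, N ≤ n → M.altRun s a (n + k) = M.altRun s a n := by
  obtain ⟨V, hv, hs⟩ : ∃ V : ℤ, (∀ i Ψ, |M.v i Ψ| ≤ V) ∧ ∀ i ω, |s.offers i ω| ≤ V := by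
    obtain ⟨A, hA⟩ := (Set.finite_range fun x : Bool × Finset Ω => |M.v x.1 x.2|).bddAbove
    obtain ⟨B, hB⟩ := (Set.finite_range fun x : Bool × Ω => |s.offers x.1 x.2|).bddAbove
    exact ⟨max A B, fun i Ψ => le_max_of_le_left (hA ⟨(i, Ψ), rfl⟩),
      fun i ω => le_max_of_le_right (hB ⟨(i, ω), rfl⟩)⟩
  have hs' : ∀ i ω, |s.offers i ω| ≤ 2 * V + 1 := fun i ω => by
    linarith [hs i ω, abs_nonneg (s.offers i ω)]
  have hfin : (Set.range fun n => M.altStep^[n] (s, a)).Finite := by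
    refine ((finite_setOf_abs_offers_le (2 * V + 1)).prod Set.finite_univ).subset ?_
    rintro _ ⟨n, rfl⟩
    simp only [iterate_altStep]
    exact ⟨abs_altRun_offers_le hv hs' a n, Set.mem_univ _⟩
  obtain ⟨N, m, hlt, heq⟩ : ∃ N m, N < m ∧ M.altStep^[N] (s, a) = M.altStep^[m] (s, a) := by
    by_contra! hne
    refine Set.infinite_range_of_injective (fun m n h => ?_) hfin
    rcases lt_trichotomy m n with hlt | rfl | hlt
    · exact absurd h (hne m n hlt)
    · rfl
    · exact absurd h.symm (hne n m hlt)
  refine ⟨N, m - N, by omega, fun n hn => ?_⟩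
  have h : M.altStep^[n + (m - N)] (s, a) = M.altStep^[n] (s, a) := by
    rw [show n + (m - N) = (n - N) + m by omega, Function.iterate_add_apply, ← heq,
      ← Function.iterate_add_apply, Nat.sub_add_cancel hn]
  rw [iterate_altStep, iterate_altStep] at h
  exact congrArg Prod.fst h

theorem even_of_altRun_add_eq {M : Market Bool Ω} {s : MState Bool Ω} {a : Bool}
    (hnc : ¬ M.AltConverges s a) {n k : ℕ}
    (h : M.altRun s a (n + 1 + k) = M.altRun s a (n + 1)) : Even k := by
  by_contra hk
  rw [Nat.not_even_iff_odd] at hk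
  refine hnc ⟨n + 1, ?_⟩
  have h₁ : (not^[n] a) ∉ (M.altRun s a (n + 1)).unsat := by
    rw [altRun_succ]
    exact notMem_unsat_mstep M _ _
  have h₂ : (not^[n + k] a) ∉ (M.altRun s a (n + 1)).unsat := by
    rw [← h, Nat.add_right_comm, altRun_succ]
    exact notMem_unsat_mstep M _ _
  rw [Nat.add_comm n k, Function.iterate_add_apply, Bool.involutive_not.iterate_odd hk] at h₂
  rw [eq_empty_iff_forall_notMem]
  intro b
  rcases Bool.eq_or_eq_not b (not^[n] a) with rfl | rfl <;> assumption

end Alternating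

end Market

/-- (i) Along any run of the market dynamic all offers stay within
`[-(2V+1), 2V+1]` whenever valuations and initial offers are bounded by `V`;
(ii) the alternating best response sequence of a two-agent market either terminates or
is eventually periodic; (iii) in a two-agent market, every cycle (eventual period) of a
non-terminating alternating sequence has even length. -/
theorem offers_bounded_and_terminate_or_cycle :
    (∀ (I Ω : Type) [Fintype I] [DecidableEq I] [Fintype Ω] [DecidableEq Ω]
        (M : Market I Ω), M.Normalized →
        ∀ V : ℕ, (∀ (i : I) (Ψ : Finset Ω), |M.v i Ψ| ≤ (V : ℤ)) →
        ∀ s : MState I Ω, (∀ (i : I) (ω : Ω), |s.offers i ω| ≤ (V : ℤ)) →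
        ∀ L : List I, M.ValidSeq s L →
        ∀ (i : I) (ω : Ω), |(M.mrun s L).offers i ω| ≤ 2 * (V : ℤ) + 1) ∧
    (∀ (Ω : Type) [Fintype Ω] [DecidableEq Ω] (M : Market Bool Ω), M.Normalized →
        ∀ (s : MState Bool Ω) (a : Bool),
        M.AltConverges s a ∨
          ∃ N k : ℕ, 0 < k ∧ ∀ n, N ≤ n → M.altRun s a (n + k) = M.altRun s a n) ∧
    (∀ (Ω : Type) [Fintype Ω] [DecidableEq Ω] (M : Market Bool Ω), M.Normalized →
        ∀ (s : MState Bool Ω) (a : Bool), ¬ M.AltConverges s a →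
        ∀ k : ℕ, 0 < k →
          (∃ N, ∀ n, N ≤ n → M.altRun s a (n + k) = M.altRun s a n) → Even k) := by
  refine ⟨?_, ?_, ?_⟩
  · intro I Ω _ _ _ _ M _ V hv s hs L _ i ω
    refine Market.abs_mrun_offers_le hv L (fun j ω' => ?_) i ω
    linarith [hs j ω', abs_nonneg (s.offers j ω')]
  · intro Ω _ _ M _ s a
    exact Or.inr (M.exists_altRun_eventually_periodic s a)
  · rintro Ω _ _ M _ s a hnc k - ⟨N, hN⟩
    exact Market.even_of_altRun_add_eq hnc (hN (N + 1) N.le_succ)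
end

section
/- In any run of the market dynamic, as soon as every agent has best responded at least once, the two offers of every trade ω differ by 0 or 1 and satisfy σ^{b(ω)}_ω ≤ σ^{s(ω)}_ω ≤ σ^{b(ω)}_ω + 1, and this property is maintained by all subsequent best responses. -/
open Finset

namespace Market

variable {I Ω : Type} [DecidableEq I] [DecidableEq Ω]

/-- The seller's offer for `ω` exceeds the buyer's offer by `0` or `1`. -/
def OffersAdjacent (M : Market I Ω) (σ : I → Ω → ℤ) (ω : Ω) : Prop :=
  σ (M.buyer ω) ω ≤ σ (M.seller ω) ω ∧ σ (M.seller ω) ω ≤ σ (M.buyer ω) ω + 1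

theorem offersAdjacent_bestResponse_buyer (M : Market I Ω) (σ : I → Ω → ℤ)
    (ω : Ω) : M.OffersAdjacent (M.bestResponse σ (M.buyer ω)) ω := by
  have hne := M.buyer_ne_seller ω
  simp only [OffersAdjacent, bestResponse, price, chi, hne.symm, true_or, and_true, if_true,
    if_false]
  split_ifs <;> omega

theorem offersAdjacent_bestResponse_seller (M : Market I Ω) (σ : I → Ω → ℤ)
    (ω : Ω) : M.OffersAdjacent (M.bestResponse σ (M.seller ω)) ω := by
  have hne := M.buyer_ne_seller ω
  simp only [OffersAdjacent, bestResponse, price, chi, hne, or_true, and_true, if_true, if_false]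
  split_ifs <;> omega

theorem OffersAdjacent.bestResponse {M : Market I Ω} {σ : I → Ω → ℤ} {ω : Ω}
    (h : M.OffersAdjacent σ ω) (i : I) : M.OffersAdjacent (M.bestResponse σ i) ω := by
  by_cases hb : M.buyer ω = i
  · exact hb ▸ M.offersAdjacent_bestResponse_buyer σ ω
  by_cases hs : M.seller ω = i
  · exact hs ▸ M.offersAdjacent_bestResponse_seller σ ω
  · simpa [OffersAdjacent, Market.bestResponse, hb, hs] using h

variable [Fintype I] [Fintype Ω]

theorem OffersAdjacent.mrun {M : Market I Ω} {ω : Ω}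
    (L : List I) {s : MState I Ω} (h : M.OffersAdjacent s.offers ω) :
    M.OffersAdjacent (M.mrun s L).offers ω := by
  induction L generalizing s with
  | nil => exact h
  | cons i L ih => exact ih (s := M.mstep s i) (h.bestResponse i)

theorem offersAdjacent_mrun_of_buyer_mem
    (M : Market I Ω) {ω : Ω} {L : List I} (hL : M.buyer ω ∈ L) (s : MState I Ω) :
    M.OffersAdjacent (M.mrun s L).offers ω := by
  induction L generalizing s with
  | nil => simp at hL
  | cons i L ih =>
    rcases List.mem_cons.mp hL with rfl | hL
    · exact OffersAdjacent.mrun L (s := M.mstep s (M.buyer ω))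
        (M.offersAdjacent_bestResponse_buyer s.offers ω)
    · exact ih hL (M.mstep s i)

end Market

/-- In any run of the market dynamic (started with all agents unsatisfied),
as soon as every agent has best responded at least once, the two offers of every trade
differ by 0 or 1 and satisfy `σ^{b(ω)}_ω ≤ σ^{s(ω)}_ω ≤ σ^{b(ω)}_ω + 1`; the property is
maintained by all subsequent best responses since `L` ranges over all (valid) sequences
containing every agent. -/
theorem offers_differ_by_at_most_one
    {I Ω : Type} [Fintype I] [DecidableEq I] [Fintype Ω] [DecidableEq Ω]
    (M : Market I Ω) (hN : M.Normalized)
    (σ0 : I → Ω → ℤ) (L : List I)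
    (hvalid : M.ValidSeq ⟨Finset.univ, σ0⟩ L)
    (hcover : ∀ i : I, i ∈ L) :
    ∀ ω : Ω,
      (M.mrun ⟨Finset.univ, σ0⟩ L).offers (M.buyer ω) ω ≤
        (M.mrun ⟨Finset.univ, σ0⟩ L).offers (M.seller ω) ω ∧
      (M.mrun ⟨Finset.univ, σ0⟩ L).offers (M.seller ω) ω ≤
        (M.mrun ⟨Finset.univ, σ0⟩ L).offers (M.buyer ω) ω + 1 := by
  intro ω
  exact M.offersAdjacent_mrun_of_buyer_mem (hcover (M.buyer ω)) _
end
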